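/- arXiv:2508.17214 — 6 statements merged into one kernel-verified Lean document; each statement's English description precedes it below -/
import Mathlib

section
/- Let p be an odd prime and let ε ∈ 𝔽_p be a non-square unit. Every nonzero nilpotent element of sl₂(𝔽_p) is conjugate under the conjugation action of SL₂(𝔽_p) to exactly one of the matrices u = [[0,0],[1,0]] and v = [[0,0],[ε,0]]; in particular, u and v are not SL₂(𝔽_p)-conjugate. -/
open Matrix in
theorem Matrix.SpecialLinearGroup.conj_eq_iff {n R : Type*} [Fintype n] [DecidableEq n]
    [CommRing R] (g : SpecialLinearGroup n R) (A B : Matrix n n R) :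
    g.val * A * g⁻¹.val = B ↔ g.val * A = B * g.val := by
  have hl : g⁻¹.val * g.val = 1 := by
    rw [← SpecialLinearGroup.coe_mul, inv_mul_cancel, SpecialLinearGroup.coe_one]
  have hr : g.val * g⁻¹.val = 1 := by
    rw [← SpecialLinearGroup.coe_mul, mul_inv_cancel, SpecialLinearGroup.coe_one]
  constructor
  · rintro rfl
    rw [Matrix.mul_assoc (g.val * A), hl, Matrix.mul_one]
  · intro h
    rw [h, Matrix.mul_assoc, hr, Matrix.mul_one]

/-- A nonzero nilpotent `2 × 2` matrix is `SL₂`-conjugate to `!![0, 0; t, 0]` for some `t ≠ 0`. -/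
theorem exists_conj_lower_of_isNilpotent {F : Type*} [Field F] (A : Matrix (Fin 2) (Fin 2) F)
    (htr : A.trace = 0) (hA : A ≠ 0) (hnil : IsNilpotent A) :
    ∃ t : F, t ≠ 0 ∧ ∃ g : Matrix.SpecialLinearGroup (Fin 2) F,
      g.val * A = !![0, 0; t, 0] * g.val := by
  have hdet : A.det = 0 := by
    obtain ⟨k, hk⟩ := hnil
    refine eq_zero_of_pow_eq_zero (n := k) ?_
    rw [← Matrix.det_pow, hk, Matrix.det_zero]
  obtain ⟨a, b, c, d, rfl⟩ : ∃ a b c d, A = !![a, b; c, d] := ⟨_, _, _, _, Matrix.eta_fin_two A⟩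
  rw [Matrix.det_fin_two_of] at hdet
  rw [Matrix.trace_fin_two_of] at htr
  obtain rfl : d = -a := by linear_combination htr
  by_cases hc : c = 0
  · subst hc
    obtain rfl : a = 0 := by
      have : a ^ 2 = 0 := by linear_combination -hdet
      simpa using this
    have hb : b ≠ 0 := by
      rintro rfl
      apply hA
      ext i j
      fin_cases i <;> fin_cases j <;> simp
    refine ⟨-b, neg_ne_zero.mpr hb, ⟨!![0, -1; 1, 0], by simp [Matrix.det_fin_two_of]⟩, ?_⟩
    simp
  · refine ⟨c, hc, ⟨!![1, -a / c; 0, 1], by simp [Matrix.det_fin_two_of]⟩, ?_⟩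
    have h1 : b + a / c * a = 0 := by
      field_simp
      linear_combination -hdet
    ext i j
    fin_cases i <;> fin_cases j <;> simp [Matrix.mul_apply, Fin.sum_univ_two] <;> field_simp
    · ring
    · linear_combination -hdet

/-- `!![0, 0; t, 0]` and `!![0, 0; r, 0]` are `SL₂`-conjugate when `t = r * s ^ 2` with `s ≠ 0`. -/
theorem exists_conj_lower_mul_sq {F : Type*} [Field F] (r s : F) (hs : s ≠ 0) :
    ∃ g : Matrix.SpecialLinearGroup (Fin 2) F,
      g.val * !![0, 0; r * s ^ 2, 0] = !![0, 0; r, 0] * g.val := by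
  refine ⟨⟨!![s, 0; 0, s⁻¹], by simp [Matrix.det_fin_two_of, hs]⟩, ?_⟩
  ext i j
  fin_cases i <;> fin_cases j <;> simp [Matrix.mul_apply, Fin.sum_univ_two]
  field_simp

theorem exists_sq_eq_of_conj_lower {F : Type*} [Field F] (ε : F)
    (g : Matrix.SpecialLinearGroup (Fin 2) F)
    (h : g.val * !![0, 0; 1, 0] = !![0, 0; ε, 0] * g.val) : ∃ x : F, x ^ 2 = ε := by
  have hdet := g.det_coe
  rw [Matrix.det_fin_two] at hdet
  have h00 := congrFun (congrFun h 0) 0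
  have h10 := congrFun (congrFun h 1) 0
  simp only [Matrix.mul_apply, Fin.sum_univ_two] at h00 h10
  simp at h00 h10
  refine ⟨g.val 1 1, ?_⟩
  linear_combination g.val 1 1 * h10 + ε * hdet + ε * g.val 1 0 * h00

theorem FiniteField.exists_eq_sq_or_eq_mul_sq {F : Type*} [Field F] [Fintype F] (ε : F)
    (hns : ∀ x : F, x ^ 2 ≠ ε) (t : F) (ht : t ≠ 0) :
    ∃ s : F, s ≠ 0 ∧ (t = s ^ 2 ∨ t = ε * s ^ 2) := by
  classical
  have hε : ε ≠ 0 := fun h => hns 0 (by simp [h])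
  have hεs : ¬ IsSquare ε := fun ⟨x, hx⟩ => hns x (by rw [hx, sq])
  by_cases hts : IsSquare t
  · obtain ⟨s, rfl⟩ := hts
    exact ⟨s, left_ne_zero_of_mul ht, Or.inl (sq s).symm⟩
  · have hmul : quadraticChar F (t * ε) = 1 := by
      rw [map_mul, quadraticChar_neg_one_iff_not_isSquare.mpr hts,
        quadraticChar_neg_one_iff_not_isSquare.mpr hεs]
      norm_num
    obtain ⟨s, hs⟩ := (quadraticChar_one_iff_isSquare (mul_ne_zero ht hε)).mp hmul
    have hs0 : s ≠ 0 := by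
      rintro rfl
      simp [ht, hε] at hs
    refine ⟨s / ε, div_ne_zero hs0 hε, Or.inr ?_⟩
    field_simp
    linear_combination hs

/-- For an odd prime `p` and a non-square unit `ε` of `𝔽_p`, every nonzero nilpotent
trace-zero `2 × 2` matrix over `𝔽_p` is `SL₂(𝔽_p)`-conjugate to exactly one of
`u = !![0,0;1,0]` and `v = !![0,0;ε,0]`; in particular `u` and `v` are not conjugate. -/
theorem sl2_regular_nilpotent_orbits (p : ℕ) (hp : p.Prime) (hodd : Odd p)
    (ε : ZMod p) (hε : IsUnit ε) (hns : ∀ x : ZMod p, x ^ 2 ≠ ε) :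
    (∀ A : Matrix (Fin 2) (Fin 2) (ZMod p), Matrix.trace A = 0 → A ≠ 0 → IsNilpotent A →
      Xor'
        (∃ g : Matrix.SpecialLinearGroup (Fin 2) (ZMod p),
          g.val * A * g⁻¹.val = !![0, 0; 1, 0])
        (∃ g : Matrix.SpecialLinearGroup (Fin 2) (ZMod p),
          g.val * A * g⁻¹.val = !![0, 0; ε, 0])) ∧
    ¬ ∃ g : Matrix.SpecialLinearGroup (Fin 2) (ZMod p),
        g.val * !![0, 0; 1, 0] * g⁻¹.val = !![0, 0; ε, 0] := by
  have : Fact p.Prime := ⟨hp⟩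
  simp only [Matrix.SpecialLinearGroup.conj_eq_iff]
  have huv : ¬ ∃ g : Matrix.SpecialLinearGroup (Fin 2) (ZMod p),
      g.val * !![0, 0; 1, 0] = !![0, 0; ε, 0] * g.val := by
    rintro ⟨g, hg⟩
    obtain ⟨x, hx⟩ := exists_sq_eq_of_conj_lower ε g hg
    exact hns x hx
  refine ⟨fun A htr hA hnil => ?_, huv⟩
  refine (xor_iff_or_and_not_and _ _).mpr ?_
  constructor
  · obtain ⟨t, ht, g, hg⟩ := exists_conj_lower_of_isNilpotent A htr hA hnil
    obtain ⟨s, hs, hts⟩ := FiniteField.exists_eq_sq_or_eq_mul_sq ε hns t ht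
    have key (r : ZMod p) (hr : t = r * s ^ 2) :
        ∃ g : Matrix.SpecialLinearGroup (Fin 2) (ZMod p),
          g.val * A = !![0, 0; r, 0] * g.val := by
      obtain ⟨k, hk⟩ := exists_conj_lower_mul_sq r s hs
      refine ⟨k * g, ?_⟩
      rw [Matrix.SpecialLinearGroup.coe_mul, Matrix.mul_assoc, hg, hr, ← Matrix.mul_assoc, hk,
        Matrix.mul_assoc]
    exact hts.imp (fun h => key 1 (by rw [h, one_mul])) (key ε)
  · rintro ⟨⟨g, hg⟩, k, hk⟩
    refine huv ⟨k * g⁻¹, ?_⟩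
    have hu := (Matrix.SpecialLinearGroup.conj_eq_iff g A _).mpr hg
    have hgg : g⁻¹.val * g.val = 1 := by
      rw [← Matrix.SpecialLinearGroup.coe_mul, inv_mul_cancel, Matrix.SpecialLinearGroup.coe_one]
    rw [← hu, Matrix.SpecialLinearGroup.coe_mul]
    simp only [Matrix.mul_assoc]
    rw [← Matrix.mul_assoc g⁻¹.val, hgg, Matrix.one_mul, ← Matrix.mul_assoc, hk, Matrix.mul_assoc]
end

section
/- Let p be an odd prime. The number of matrices in the SL₂(𝔽_p)-conjugacy class of [[0,1],[0,0]] (under conjugation g·A·g⁻¹) whose (1,2)-entry is 0 (i.e. which are lower triangular) is exactly (p−1)/2. -/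
theorem exists_conj_single_and_apply_zero_one_eq_zero_iff {F : Type*} [Field F]
    (A : Matrix (Fin 2) (Fin 2) F) :
    ((∃ g : Matrix.SpecialLinearGroup (Fin 2) F,
        g.val * !![0, 1; 0, 0] * g⁻¹.val = A) ∧ A 0 1 = 0) ↔
      ∃ c : Fˣ, !![0, 0; -(c : F) ^ 2, 0] = A := by
  constructor
  · rintro ⟨⟨g, rfl⟩, h⟩
    have hdet := g.det_coe
    rw [Matrix.det_fin_two] at hdet
    rw [Matrix.SpecialLinearGroup.coe_inv, Matrix.adjugate_fin_two] at h ⊢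
    have ha : g.val 0 0 = 0 := by
      simpa [Matrix.mul_apply, Fin.sum_univ_two] using h
    have hc : g.val 1 0 ≠ 0 := by
      intro hc
      simp [ha, hc] at hdet
    refine ⟨Units.mk0 _ hc, ?_⟩
    ext i j
    fin_cases i <;> fin_cases j <;>
      simp [Matrix.mul_apply, Fin.sum_univ_two, ha, sq]
  · rintro ⟨c, rfl⟩
    obtain ⟨g, hg⟩ : ∃ g : Matrix.SpecialLinearGroup (Fin 2) F,
        g.val = !![0, -(c : F)⁻¹; (c : F), 0] :=
      ⟨⟨_, by simp [Matrix.det_fin_two_of]⟩, rfl⟩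
    refine ⟨⟨g, ?_⟩, by simp⟩
    rw [Matrix.SpecialLinearGroup.coe_inv, hg, Matrix.adjugate_fin_two_of]
    ext i j
    fin_cases i <;> fin_cases j <;> simp [Matrix.mul_apply, Fin.sum_univ_two, sq]

/-- For an odd prime `p`, the number of matrices in the `SL₂(𝔽_p)`-conjugacy class of
`!![0,1;0,0]` whose `(1,2)`-entry is `0` is exactly `(p-1)/2`. -/
theorem lower_triangular_in_orbit_card (p : ℕ) (hp : p.Prime) (hodd : Odd p) :
    Set.ncard {A : Matrix (Fin 2) (Fin 2) (ZMod p) |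
        (∃ g : Matrix.SpecialLinearGroup (Fin 2) (ZMod p),
          g.val * !![0, 1; 0, 0] * g⁻¹.val = A) ∧ A 0 1 = 0} = (p - 1) / 2 := by
  have : Fact p.Prime := ⟨hp⟩
  simp_rw [exists_conj_single_and_apply_zero_one_eq_zero_iff]
  let f : (ZMod p)ˣ → Matrix (Fin 2) (Fin 2) (ZMod p) := fun u ↦ !![0, 0; -(u : ZMod p), 0]
  have hf : Function.Injective f := by
    intro u v h
    simpa [f, Units.ext_iff] using congrFun (congrFun h 1) 0
  have hS : {A : Matrix (Fin 2) (Fin 2) (ZMod p) |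
      ∃ c : (ZMod p)ˣ, !![0, 0; -(c : ZMod p) ^ 2, 0] = A} =
      f '' ((powMonoidHom 2 : (ZMod p)ˣ →* (ZMod p)ˣ).range : Set (ZMod p)ˣ) := by
    ext A
    simp [f]
  rw [hS, Set.ncard_image_of_injective _ hf, ← Nat.card_coe_set_eq]
  have hdvd : 2 ∣ p - 1 := (Nat.Odd.sub_odd hodd odd_one).two_dvd
  have h := IsCyclic.card_powMonoidHom_range (G := (ZMod p)ˣ) 2
  rwa [Nat.card_eq_fintype_card (α := (ZMod p)ˣ), ZMod.card_units, Nat.gcd_eq_right hdvd] at h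
end

section
/- Let p be an odd prime, ζ_p = exp(2πi/p) ∈ ℂ, and let ε ∈ 𝔽_p be a non-square unit. For every b ∈ 𝔽_p one has (1/2)·( Σ_{h ∈ 𝔽_p} ζ_p^{b·h²} − Σ_{h ∈ 𝔽_p} ζ_p^{ε·b·h²} ) = (b/p)·√p if p ≡ 1 (mod 4), and = (b/p)·i·√p if p ≡ 3 (mod 4), where (b/p) denotes the Legendre symbol and exponents are computed via any integer representatives of the elements b·h², ε·b·h² of 𝔽_p. -/
open Filter Topology in
/-- The two-variable theta function at real `z` tends to `1` as `im τ → ∞`. -/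
lemma tendsto_jacobiTheta₂_of_im_atTop {α : Type*} {l : Filter α} {τ : α → ℂ} (x : ℝ)
    (h : Tendsto (fun t ↦ (τ t).im) l atTop) :
    Tendsto (fun t ↦ jacobiTheta₂ x (τ t)) l (𝓝 1) := by
  have hb : Summable fun n : ℤ ↦ ‖jacobiTheta₂_term n x Complex.I‖ :=
    ((summable_jacobiTheta₂_term_iff x Complex.I).2 (by simp)).norm
  have key := tendsto_tsum_of_dominated_convergence (𝓕 := l)
    (f := fun t n ↦ jacobiTheta₂_term n x (τ t)) (g := fun n : ℤ ↦ if n = 0 then (1 : ℂ) else 0)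
    hb ?_ ?_
  · simpa [jacobiTheta₂] using key
  · intro n
    split_ifs with hn
    · simpa [hn, jacobiTheta₂_term] using tendsto_const_nhds
    · rw [tendsto_zero_iff_norm_tendsto_zero]
      simp_rw [norm_jacobiTheta₂_term]
      refine Real.tendsto_exp_atBot.comp ?_
      have hc : -Real.pi * (n : ℝ) ^ 2 < 0 := by
        have : (0 : ℝ) < (n : ℝ) ^ 2 := by positivity
        nlinarith [Real.pi_pos]
      simpa using h.const_mul_atTop_of_neg hc
  · filter_upwards [h.eventually_ge_atTop 1] with t ht n
    simp only [norm_jacobiTheta₂_term, Complex.I_im, Complex.ofReal_im, mul_zero, sub_zero]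
    rw [Real.exp_le_exp]
    have : 0 ≤ Real.pi * (n : ℝ) ^ 2 := by positivity
    nlinarith

/-- The principal square root is compatible with multiplication by a nonnegative real. -/
lemma Complex.ofReal_mul_cpow_half {r : ℝ} (hr : 0 ≤ r) (z : ℂ) :
    ((r : ℂ) * z) ^ (1 / 2 : ℂ) = Real.sqrt r * z ^ (1 / 2 : ℂ) := by
  rcases hr.eq_or_lt with rfl | hr
  · simp
  rcases eq_or_ne z 0 with rfl | hz
  · simp
  have hr' : (r : ℂ) ≠ 0 := by exact_mod_cast hr.ne'
  rw [Complex.cpow_def_of_ne_zero (mul_ne_zero hr' hz), Complex.log_ofReal_mul hr hz, add_mul,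
    Complex.exp_add, Complex.cpow_def_of_ne_zero hz, Real.sqrt_eq_rpow,
    Complex.ofReal_cpow hr.le, Complex.cpow_def_of_ne_zero hr', Complex.ofReal_log hr.le]
  simp

lemma exp_mul_jacobiTheta₂_term (a n : ℤ) (N : ℕ) (w : ℂ) :
    Complex.exp (Real.pi * Complex.I * a ^ 2 * w) * jacobiTheta₂_term n (a * N * w) (N ^ 2 * w) =
      Complex.exp (Real.pi * Complex.I * (n * N + a) ^ 2 * w) := by
  rw [jacobiTheta₂_term, ← Complex.exp_add]
  ring_nf

/-- Poisson summation for the theta series over a residue class. -/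
lemma hasSum_exp_sq_residueClass (N : ℕ) [NeZero N] (a : ℤ) {w : ℂ} (hw : 0 < w.im) :
    HasSum (fun n : ℤ ↦ Complex.exp (Real.pi * Complex.I * (n * N + a) ^ 2 * w))
      (1 / (N * (-Complex.I * w) ^ (1 / 2 : ℂ)) *
        jacobiTheta₂ ((a / N : ℝ) : ℂ) (-1 / (N ^ 2 * w))) := by
  have hN : (N : ℂ) ≠ 0 := NeZero.ne _
  have hN' : (0 : ℝ) < N := by exact_mod_cast Nat.pos_of_ne_zero (NeZero.ne N)
  have hw0 : w ≠ 0 := by rintro rfl; simp at hw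
  have him : 0 < ((N : ℂ) ^ 2 * w).im := by
    have : ((N : ℂ) ^ 2 * w).im = (N : ℝ) ^ 2 * w.im := by
      rw [show (N : ℂ) ^ 2 = (((N : ℝ) ^ 2 : ℝ) : ℂ) by push_cast; rfl, Complex.im_ofReal_mul]
    rw [this]; positivity
  have h := (hasSum_jacobiTheta₂_term (a * N * w) him).mul_left
    (Complex.exp (Real.pi * Complex.I * a ^ 2 * w))
  simp_rw [exp_mul_jacobiTheta₂_term] at h
  refine Eq.subst (motive := fun s ↦ HasSum _ s) ?_ h
  rw [jacobiTheta₂_functional_equation]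
  have h1 : -Complex.I * ((N : ℂ) ^ 2 * w) = (((N : ℝ) ^ 2 : ℝ) : ℂ) * (-Complex.I * w) := by
    push_cast; ring
  have h2 : (a * N * w : ℂ) / (N ^ 2 * w) = ((a / N : ℝ) : ℂ) := by
    push_cast; field_simp
  have h3 : -(Real.pi : ℂ) * Complex.I * (a * N * w) ^ 2 / (N ^ 2 * w) =
      -(Real.pi * Complex.I * a ^ 2 * w) := by
    field_simp
  rw [h1, Complex.ofReal_mul_cpow_half (by positivity), Real.sqrt_sq hN'.le, h2, h3,
    Complex.exp_neg]
  have := Complex.exp_ne_zero (Real.pi * Complex.I * a ^ 2 * w)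
  field_simp
  push_cast
  rw [mul_div_cancel_left₀ _ hN]

/-- Expansion of the Jacobi theta function near a point `r` at which `n ↦ exp (π i n² r)`
is periodic. -/
lemma jacobiTheta_add_eq_sum (N : ℕ) [NeZero N] {r : ℂ}
    (hr : ∀ n a : ℤ, Complex.exp (Real.pi * Complex.I * (n * N + a) ^ 2 * r) =
      Complex.exp (Real.pi * Complex.I * a ^ 2 * r))
    {w : ℂ} (hw : 0 < w.im) (hrw : 0 < (r + w).im) :
    N * (-Complex.I * w) ^ (1 / 2 : ℂ) * jacobiTheta (r + w) =
      ∑ a : Fin N, Complex.exp (Real.pi * Complex.I * (a : ℕ) ^ 2 * r) *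
        jacobiTheta₂ (((a : ℕ) / N : ℝ) : ℂ) (-1 / (N ^ 2 * w)) := by
  have hN : (N : ℂ) ≠ 0 := NeZero.ne _
  have hw0 : w ≠ 0 := by rintro rfl; simp at hw
  have hc : (-Complex.I * w) ^ (1 / 2 : ℂ) ≠ 0 := by
    simp [Complex.cpow_eq_zero_iff, hw0]
  have hs := hasSum_jacobiTheta₂_term 0 hrw
  rw [← jacobiTheta_eq_jacobiTheta₂] at hs
  have hs' := ((Equiv.prodComm _ _).trans (Int.divModEquiv N).symm).hasSum_iff.2 hs
  have hfib (a : Fin N) := (hasSum_exp_sq_residueClass N (a : ℕ) hw).mul_left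
    (Complex.exp (Real.pi * Complex.I * (a : ℕ) ^ 2 * r))
  have hsum := (hs'.prod_fiberwise (g := fun a : Fin N ↦
      Complex.exp (Real.pi * Complex.I * (a : ℕ) ^ 2 * r) *
      (1 / (N * (-Complex.I * w) ^ (1 / 2 : ℂ)) *
        jacobiTheta₂ (((a : ℕ) / N : ℝ) : ℂ) (-1 / (N ^ 2 * w)))) ?_).unique (hasSum_fintype _)
  · rw [hsum, Finset.mul_sum]
    refine Finset.sum_congr rfl fun a _ ↦ ?_
    field_simp
  · intro a
    refine Eq.subst (motive := fun f ↦ HasSum f _) (funext fun n ↦ ?_) (hfib a)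
    have := hr n (a : ℕ)
    push_cast at this
    rw [Int.cast_natCast, ← this, ← Complex.exp_add]
    simp only [Function.comp_apply, jacobiTheta₂_term, Equiv.trans_apply, Equiv.prodComm_apply,
      Int.divModEquiv, Equiv.coe_fn_symm_mk, Prod.swap]
    push_cast
    ring_nf

open Filter Topology in
lemma tendsto_jacobiTheta_add (N : ℕ) [NeZero N] {r : ℂ} (hr0 : r.im = 0)
    (hr : ∀ n a : ℤ, Complex.exp (Real.pi * Complex.I * (n * N + a) ^ 2 * r) =
      Complex.exp (Real.pi * Complex.I * a ^ 2 * r))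
    {α : Type*} {l : Filter α} {w : α → ℂ} (hw : ∀ᶠ t in l, 0 < (w t).im)
    (hw' : Tendsto (fun t ↦ (-1 / w t).im) l atTop) :
    Tendsto (fun t ↦ N * (-Complex.I * w t) ^ (1 / 2 : ℂ) * jacobiTheta (r + w t)) l
      (𝓝 (∑ a : Fin N, Complex.exp (Real.pi * Complex.I * (a : ℕ) ^ 2 * r))) := by
  have hN : (0 : ℝ) < N := by exact_mod_cast Nat.pos_of_ne_zero (NeZero.ne N)
  have him : Tendsto (fun t ↦ (-1 / ((N : ℂ) ^ 2 * w t)).im) l atTop := by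
    have h (t : α) : (-1 / ((N : ℂ) ^ 2 * w t)).im = ((N : ℝ) ^ 2)⁻¹ * (-1 / w t).im := by
      rw [← Complex.im_ofReal_mul]
      congr 1
      push_cast
      rw [div_mul_eq_div_div_swap, div_eq_inv_mul]
    simp_rw [h]
    exact hw'.const_mul_atTop (by positivity)
  have key : Tendsto (fun t ↦ ∑ a : Fin N, Complex.exp (Real.pi * Complex.I * (a : ℕ) ^ 2 * r) *
      jacobiTheta₂ (((a : ℕ) / N : ℝ) : ℂ) (-1 / (N ^ 2 * w t))) l
      (𝓝 (∑ a : Fin N, Complex.exp (Real.pi * Complex.I * (a : ℕ) ^ 2 * r) * 1)) :=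
    tendsto_finsetSum _ fun a _ ↦
      (tendsto_jacobiTheta₂_of_im_atTop ((a : ℕ) / N : ℝ) him).const_mul _
  simp only [mul_one] at key
  refine key.congr' ?_
  filter_upwards [hw] with t ht
  exact (jacobiTheta_add_eq_sum N hr ht (by simpa [hr0] using ht)).symm

open Filter Topology in
/-- Reciprocity for the quadratic Gauss sum, from the modularity of the theta function. -/
lemma sum_exp_sq_mul_cpow (p : ℕ) [NeZero p] :
    (∑ a : Fin p, Complex.exp (Real.pi * Complex.I * (a : ℕ) ^ 2 * (2 / p))) *
      (-(2 * Complex.I) / p) ^ (1 / 2 : ℂ) = 1 + (-Complex.I) ^ p := by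
  have hp : (0 : ℝ) < p := by exact_mod_cast Nat.pos_of_ne_zero (NeZero.ne p)
  have hpC : (p : ℂ) ≠ 0 := NeZero.ne _
  have hper1 (n a : ℤ) : Complex.exp (Real.pi * Complex.I * (n * p + a) ^ 2 * (2 / p)) =
      Complex.exp (Real.pi * Complex.I * a ^ 2 * (2 / p)) := by
    rw [Complex.exp_eq_exp_iff_exists_int]
    refine ⟨n ^ 2 * p + 2 * n * a, ?_⟩
    push_cast
    field_simp
    ring
  have hper2 (n a : ℤ) : Complex.exp (Real.pi * Complex.I * (n * (2 : ℕ) + a) ^ 2 * (-p / 2)) =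
      Complex.exp (Real.pi * Complex.I * a ^ 2 * (-p / 2)) := by
    rw [Complex.exp_eq_exp_iff_exists_int]
    refine ⟨-p * (n ^ 2 + n * a), ?_⟩
    push_cast
    field_simp
    ring
  have hpos : ∀ᶠ t : ℝ in 𝓝[>] 0, 0 < t := eventually_mem_nhdsWithin
  have hD (t : ℝ) : (2 / p + t * Complex.I : ℂ) ≠ 0 := by
    intro h
    have := congrArg Complex.re h
    rw [show (2 / p : ℂ) = ((2 / p : ℝ) : ℂ) by push_cast; rfl] at this
    simp at this
    simp [this] at hp
  let v : ℝ → ℂ := fun t ↦ (p / 2) / (2 / p + t * Complex.I)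
  have hv : Tendsto (fun t ↦ (v t) ^ (1 / 2 : ℂ)) (𝓝[>] 0) (𝓝 (p / 2)) := by
    have h0 : (v 0) ^ (1 / 2 : ℂ) = p / 2 := by
      have : v 0 = ((p / 2 : ℝ) : ℂ) ^ 2 := by
        simp only [v]; push_cast; field_simp; simp
      rw [this, one_div, Complex.sq_cpow_two_inv (by simpa using hp)]
      push_cast; rfl
    rw [← h0]
    have hc : ContinuousAt v 0 :=
      ContinuousAt.div (by fun_prop) (by fun_prop) (hD 0)
    refine (hc.cpow continuousAt_const ?_).tendsto.mono_left nhdsWithin_le_nhds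
    have : v 0 = ((p ^ 2 / 4 : ℝ) : ℂ) := by
      simp only [v]; push_cast; field_simp; norm_num
    rw [this, Complex.ofReal_mem_slitPlane]
    positivity
  have hτ : Tendsto (fun t : ℝ ↦ (-Complex.I * (2 / p + t * Complex.I)) ^ (1 / 2 : ℂ)) (𝓝[>] 0)
      (𝓝 ((-(2 * Complex.I) / p) ^ (1 / 2 : ℂ))) := by
    have h0 : -(2 * Complex.I) / p = -Complex.I * (2 / p + (0 : ℝ) * Complex.I) := by
      simp; ring
    rw [h0]
    refine ((ContinuousAt.cpow (f := fun t : ℝ ↦ -Complex.I * (2 / p + t * Complex.I)) (by fun_prop)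
      continuousAt_const ?_).tendsto.mono_left nhdsWithin_le_nhds)
    right
    rw [show (-Complex.I * (2 / p + (0 : ℝ) * Complex.I) : ℂ) = ((-2 / p : ℝ) : ℂ) * Complex.I by
      push_cast; ring, Complex.im_ofReal_mul]
    simp [hp.ne']
  have hA := tendsto_jacobiTheta_add p (r := 2 / p)
    (by rw [show (2 / p : ℂ) = ((2 / p : ℝ) : ℂ) by push_cast; rfl, Complex.ofReal_im])
    hper1 (l := 𝓝[>] 0) (w := fun t : ℝ ↦ t * Complex.I)
    (by filter_upwards [hpos] with t ht; simpa using ht) (by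
      have h (t : ℝ) : (-1 / (t * Complex.I) : ℂ).im = t⁻¹ := by
        rw [show (-1 / (t * Complex.I) : ℂ) = ((t⁻¹ : ℝ) : ℂ) * Complex.I by
          push_cast
          rw [div_mul_eq_div_div, Complex.div_I]; ring]
        simp
      simp_rw [h]
      exact tendsto_inv_nhdsGT_zero)
  have hinv (t : ℝ) (ht : 0 < t) : (-1 / (t * Complex.I * v t) : ℂ) =
      ((4 / p ^ 2 * t⁻¹ : ℝ) : ℂ) * Complex.I + ((-2 / p : ℝ) : ℂ) := by
    have := hD t
    have ht' : (t : ℂ) ≠ 0 := by exact_mod_cast ht.ne'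
    have hI := Complex.I_sq
    simp only [v]
    push_cast
    field_simp
    linear_combination (-4 : ℂ) * hI
  have hiv (t : ℝ) (ht : 0 < t) : 0 < (t * Complex.I * v t : ℂ).im := by
    have h1 : (t * Complex.I * v t : ℂ) = -(-1 / (t * Complex.I * v t))⁻¹ := by
      rw [inv_div]; simp [div_neg]
    have h2 : 0 < (-1 / (t * Complex.I * v t) : ℂ).im := by
      rw [hinv t ht]
      simp only [Complex.add_im, Complex.im_ofReal_mul, Complex.I_im, Complex.ofReal_im]
      positivity
    rw [h1, Complex.neg_im, Complex.inv_im, neg_div, neg_neg]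
    refine div_pos h2 (Complex.normSq_pos.2 fun h ↦ ?_)
    simp [h] at h2
  have hB := tendsto_jacobiTheta_add 2 (r := -p / 2)
    (by rw [show (-p / 2 : ℂ) = ((-p / 2 : ℝ) : ℂ) by push_cast; rfl, Complex.ofReal_im])
    hper2 (l := 𝓝[>] 0) (w := fun t : ℝ ↦ t * Complex.I * v t)
    (by filter_upwards [hpos] with t ht using hiv t ht) (by
      have h : Tendsto (fun t : ℝ ↦ 4 / (p : ℝ) ^ 2 * t⁻¹) (𝓝[>] 0) atTop :=
        tendsto_inv_nhdsGT_zero.const_mul_atTop (by positivity)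
      refine h.congr' ?_
      filter_upwards [hpos] with t ht
      rw [hinv t ht]
      simp only [Complex.add_im, Complex.im_ofReal_mul, Complex.I_im, Complex.ofReal_im]
      ring)
  have hsum2 : ∑ a : Fin 2, Complex.exp (Real.pi * Complex.I * (a : ℕ) ^ 2 * (-p / 2)) =
      1 + (-Complex.I) ^ p := by
    rw [Fin.sum_univ_two, ← Complex.exp_neg_pi_div_two_mul_I, ← Complex.exp_nat_mul]
    simp
    ring_nf
  rw [hsum2] at hB
  have hE := tendsto_nhds_unique (((hA.mul hτ).mul (hv.const_mul 2)).congr' ?_)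
    (hB.const_mul (p : ℂ))
  · refine mul_right_cancel₀ hpC ?_
    linear_combination hE
  · filter_upwards [hpos] with t ht
    have hth : jacobiTheta (2 / p + t * Complex.I) =
        1 / (-Complex.I * (2 / p + t * Complex.I)) ^ (1 / 2 : ℂ) *
          jacobiTheta (-p / 2 + t * Complex.I * v t) := by
      rw [jacobiTheta_eq_jacobiTheta₂, jacobiTheta_eq_jacobiTheta₂,
        jacobiTheta₂_functional_equation]
      have : (-1 / (2 / p + t * Complex.I) : ℂ) = -p / 2 + t * Complex.I * v t := by
        simp only [v]
        rw [div_eq_iff (hD t), add_mul, mul_assoc, div_mul_cancel₀ _ (hD t)]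
        field_simp
        ring
      simp [this]
    have hc : (-Complex.I * (2 / p + t * Complex.I)) ^ (1 / 2 : ℂ) ≠ 0 := by
      simp [Complex.cpow_eq_zero_iff, hD t]
    rw [hth, show -Complex.I * (t * Complex.I * v t) = (t : ℂ) * v t by
        linear_combination (-(t : ℂ) * v t) * Complex.I_sq,
      show -Complex.I * (t * Complex.I) = (t : ℂ) * 1 by
        linear_combination (-(t : ℂ)) * Complex.I_sq,
      Complex.ofReal_mul_cpow_half ht.le, Complex.ofReal_mul_cpow_half ht.le, Complex.one_cpow]
    generalize (-Complex.I * (2 / p + t * Complex.I)) ^ (1 / 2 : ℂ) = c at hc ⊢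
    field_simp
    push_cast
    ring

/-- Gauss's evaluation of the quadratic Gauss sum. -/
lemma sum_stdAddChar_sq_mul (p : ℕ) [NeZero p] :
    (∑ h : ZMod p, ZMod.stdAddChar (h ^ 2)) * (1 - Complex.I) =
      (1 + (-Complex.I) ^ p) * Real.sqrt p := by
  have hp : (0 : ℝ) < p := by exact_mod_cast Nat.pos_of_ne_zero (NeZero.ne p)
  have hs : (0 : ℝ) < Real.sqrt p := Real.sqrt_pos.2 hp
  have hs' : (Real.sqrt p : ℂ) ≠ 0 := by exact_mod_cast hs.ne'
  have hs2 : (Real.sqrt p : ℂ) ^ 2 = p := by exact_mod_cast Real.sq_sqrt hp.le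
  have hroot : (-(2 * Complex.I) / p : ℂ) ^ (1 / 2 : ℂ) = (1 - Complex.I) / Real.sqrt p := by
    have : (-(2 * Complex.I) / p : ℂ) = ((1 - Complex.I) / Real.sqrt p) ^ 2 := by
      rw [div_pow, hs2]
      congr 1
      linear_combination -Complex.I_sq
    rw [this, one_div, Complex.sq_cpow_two_inv]
    rw [Complex.div_ofReal_re]
    simpa using hp
  have hsum : ∑ h : ZMod p, ZMod.stdAddChar (h ^ 2) =
      ∑ a : Fin p, Complex.exp (Real.pi * Complex.I * (a : ℕ) ^ 2 * (2 / p)) := by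
    refine (Function.Bijective.sum_comp (e := fun a : Fin p ↦ ((a : ℕ) : ZMod p)) ?_ _).symm.trans
      (Finset.sum_congr rfl fun a _ ↦ ?_)
    · rw [Fintype.bijective_iff_injective_and_card, ZMod.card, Fintype.card_fin]
      refine ⟨fun a b hab ↦ Fin.ext ?_, rfl⟩
      simpa [ZMod.val_cast_of_lt a.2, ZMod.val_cast_of_lt b.2] using congrArg ZMod.val hab
    have := ZMod.stdAddChar_coe (N := p) ((a : ℕ) ^ 2 : ℤ)
    push_cast at this
    rw [this]
    ring_nf
  have h := sum_exp_sq_mul_cpow p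
  rw [hroot, ← hsum] at h
  rw [← h]
  field_simp

lemma sum_stdAddChar_mul_sq (p : ℕ) [Fact p.Prime] (hp : p ≠ 2) {a : ZMod p} (ha : a ≠ 0) :
    ∑ h : ZMod p, (ZMod.stdAddChar (a * h ^ 2) : ℂ) =
      quadraticChar (ZMod p) a * ∑ h : ZMod p, (ZMod.stdAddChar (h ^ 2) : ℂ) := by
  have hring : ringChar (ZMod p) ≠ 2 := by rwa [ZMod.ringChar_zmod_n]
  let χ : MulChar (ZMod p) ℂ := (quadraticChar (ZMod p)).ringHomComp (Int.castRingHom ℂ)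
  have key (b : ZMod p) (hb : b ≠ 0) : ∑ h : ZMod p, (ZMod.stdAddChar (b * h ^ 2) : ℂ) =
      gaussSum χ (ZMod.stdAddChar.mulShift b) := by
    have h0 : ∑ x : ZMod p, (ZMod.stdAddChar (b * x) : ℂ) = 0 := by
      simpa [mul_comm, hb] using AddChar.sum_mulShift b (ZMod.isPrimitive_stdAddChar p)
    calc _ = ∑ x : ZMod p, ∑ h : ZMod p with h ^ 2 = x, (ZMod.stdAddChar (b * h ^ 2) : ℂ) :=
          (Finset.sum_fiberwise _ _ _).symm
      _ = ∑ x : ZMod p, ((quadraticChar (ZMod p) x : ℂ) + 1) * ZMod.stdAddChar (b * x) := by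
          refine Finset.sum_congr rfl fun x _ ↦ ?_
          rw [Finset.sum_congr rfl (g := fun _ ↦ ZMod.stdAddChar (b * x))
            (fun h hh ↦ by rw [(Finset.mem_filter.1 hh).2]), Finset.sum_const, nsmul_eq_mul]
          congr 1
          have := quadraticChar_card_sqrts hring x
          rw [Set.toFinset_ofPred] at this
          exact_mod_cast this
      _ = _ := by
          simp only [add_mul, one_mul, Finset.sum_add_distrib, h0, add_zero]
          rfl
  have h1 := key 1 one_ne_zero
  simp only [one_mul, AddChar.mulShift_one] at h1
  rw [key a ha, h1, ← gaussSum_mulShift χ ZMod.stdAddChar (Units.mk0 a ha), ← mul_assoc]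
  have : (quadraticChar (ZMod p) a : ℂ) * χ a = 1 := by
    change (quadraticChar (ZMod p) a : ℂ) * (quadraticChar (ZMod p) a : ℂ) = 1
    rw [← sq]
    exact_mod_cast quadraticChar_sq_one ha
  rw [Units.val_mk0, this, one_mul]

lemma half_sum_stdAddChar_sub (p : ℕ) [Fact p.Prime] (hp : p ≠ 2) {ε : ZMod p}
    (hns : ∀ x : ZMod p, x ^ 2 ≠ ε) (b : ZMod p) :
    (1 / 2 : ℂ) * (∑ h : ZMod p, ZMod.stdAddChar (b * h ^ 2) -
      ∑ h : ZMod p, ZMod.stdAddChar (ε * b * h ^ 2)) =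
      quadraticChar (ZMod p) b * ∑ h : ZMod p, (ZMod.stdAddChar (h ^ 2) : ℂ) := by
  rcases eq_or_ne b 0 with rfl | hb
  · simp
  have hε0 : ε ≠ 0 := fun h ↦ hns 0 (by simp [h])
  have hε : quadraticChar (ZMod p) ε = -1 := by
    rw [quadraticChar_neg_one_iff_not_isSquare]
    rintro ⟨x, hx⟩
    exact hns x (by rw [hx, sq])
  rw [sum_stdAddChar_mul_sq p hp hb, sum_stdAddChar_mul_sq p hp (mul_ne_zero hε0 hb), map_mul, hε]
  push_cast
  ring

lemma exp_two_pi_I_div_pow_val (p : ℕ) [NeZero p] (x : ZMod p) :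
    Complex.exp (2 * Real.pi * Complex.I / p) ^ x.val = ZMod.stdAddChar x := by
  rw [ZMod.stdAddChar_apply, ZMod.toCircle_apply, ← Complex.exp_nat_mul]
  ring_nf


open Complex in
/-- For an odd prime `p`, a non-square unit `ε` of `𝔽_p`, and `b ∈ 𝔽_p`, the normalised
difference of the two quadratic Gauss-type sums equals `(b/p)·√p` when `p ≡ 1 (mod 4)`
and `(b/p)·i·√p` when `p ≡ 3 (mod 4)`. -/
theorem gauss_sum_difference (p : ℕ) [Fact p.Prime] (hodd : Odd p)
    (ε : ZMod p) (hε : IsUnit ε) (hns : ∀ x : ZMod p, x ^ 2 ≠ ε) (b : ZMod p) :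
    (p % 4 = 1 →
      (1 / 2 : ℂ) *
          ((∑ h : ZMod p, Complex.exp (2 * Real.pi * Complex.I / p) ^ (b * h ^ 2).val) -
            ∑ h : ZMod p, Complex.exp (2 * Real.pi * Complex.I / p) ^ (ε * b * h ^ 2).val) =
        (legendreSym p (b.val : ℤ) : ℂ) * Real.sqrt p) ∧
    (p % 4 = 3 →
      (1 / 2 : ℂ) *
          ((∑ h : ZMod p, Complex.exp (2 * Real.pi * Complex.I / p) ^ (b * h ^ 2).val) -
            ∑ h : ZMod p, Complex.exp (2 * Real.pi * Complex.I / p) ^ (ε * b * h ^ 2).val) =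
        (legendreSym p (b.val : ℤ) : ℂ) * Complex.I * Real.sqrt p) := by
  have hp2 : p ≠ 2 := by rintro rfl; exact absurd hodd (by decide)
  have hI4 : (-Complex.I) ^ 4 = 1 := by rw [neg_pow, Complex.I_pow_four]; norm_num
  have hI1 : (1 - Complex.I) ≠ 0 := fun h ↦ by simpa using congrArg Complex.re h
  have hleg : legendreSym p (b.val : ℤ) = quadraticChar (ZMod p) b := by
    simp [legendreSym]
  simp_rw [exp_two_pi_I_div_pow_val, half_sum_stdAddChar_sub p hp2 hns b, hleg]
  have hG := sum_stdAddChar_sq_mul p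
  refine ⟨fun h ↦ ?_, fun h ↦ ?_⟩
  · rw [pow_eq_pow_mod p hI4, h, pow_one] at hG
    congr 1
    refine mul_right_cancel₀ hI1 ?_
    linear_combination hG
  · rw [pow_eq_pow_mod p hI4, h] at hG
    rw [mul_assoc]
    congr 1
    refine mul_right_cancel₀ hI1 ?_
    linear_combination hG + (Real.sqrt p : ℂ) * (1 - Complex.I) * Complex.I_sq
end

section
/- Let p be an odd prime, r ≥ 2 an integer, and let u₀ = [[1, p^{r−1}],[0,1]] ∈ SL₂(ℤ/p^rℤ). Let H be the subgroup of SL₂(ℤ/p^rℤ) generated by [[1,1],[0,1]] and −I₂. Then for h ∈ SL₂(ℤ/p^rℤ), one has h·u₀·h⁻¹ ∈ H if and only if the (2,1)-entry of h is divisible by p in ℤ/p^rℤ. -/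
namespace Matrix.SpecialLinearGroup

variable {R : Type*} [CommRing R]

theorem val_pow_of_val_eq_upper_unipotent {t : SpecialLinearGroup (Fin 2) R}
    (ht : t.val = !![1, 1; 0, 1]) (n : ℕ) : (t ^ n).val = !![1, (n : R); 0, 1] := by
  induction n with
  | zero => simp [Matrix.one_fin_two]
  | succ n ih =>
    rw [pow_succ, coe_mul, ih, ht]
    simp [add_comm]

theorem val_one_zero_eq_zero_of_mem_closure {S : Set (SpecialLinearGroup (Fin 2) R)}
    (hS : ∀ g ∈ S, g.val 1 0 = 0) {g : SpecialLinearGroup (Fin 2) R}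
    (hg : g ∈ Subgroup.closure S) : g.val 1 0 = 0 := by
  induction hg using Subgroup.closure_induction with
  | mem g hg => exact hS g hg
  | one => simp
  | mul x y _ _ hx hy => simp [coe_mul, Matrix.mul_apply, Fin.sum_univ_two, hx, hy]
  | inv x _ hx => simp [coe_inv, Matrix.adjugate_fin_two, hx]

theorem val_conj_of_val_eq_upper_unipotent {u : SpecialLinearGroup (Fin 2) R} {q : R}
    (hu : u.val = !![1, q; 0, 1]) (h : SpecialLinearGroup (Fin 2) R) :
    (h * u * h⁻¹).val =
      !![1 - q * (h.val 0 0 * h.val 1 0), q * h.val 0 0 ^ 2;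
        -(q * h.val 1 0 ^ 2), 1 + q * (h.val 0 0 * h.val 1 0)] := by
  have hdet := h.det_coe
  rw [Matrix.det_fin_two] at hdet
  rw [coe_mul, coe_mul, coe_inv, hu, Matrix.adjugate_fin_two, Matrix.eta_fin_two h.val]
  ext i j
  fin_cases i <;> fin_cases j <;> simp <;> first | ring1 | linear_combination hdet

end Matrix.SpecialLinearGroup

theorem ZMod.natCast_pow_pred_mul_eq_zero_iff_dvd {p r : ℕ} (hp : p ≠ 0) (hr : r ≠ 0)
    (x : ZMod (p ^ r)) : (p : ZMod (p ^ r)) ^ (r - 1) * x = 0 ↔ (p : ZMod (p ^ r)) ∣ x := by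
  have : NeZero (p ^ r) := ⟨pow_ne_zero r hp⟩
  obtain ⟨k, rfl⟩ := Nat.exists_eq_succ_of_ne_zero hr
  constructor
  · intro h
    rw [← ZMod.natCast_zmod_val x] at h ⊢
    have h' : ((p ^ k * x.val : ℕ) : ZMod (p ^ (k + 1))) = 0 := by
      push_cast
      simpa using h
    rw [ZMod.natCast_eq_zero_iff] at h'
    exact Nat.cast_dvd_cast
      (Nat.dvd_of_mul_dvd_mul_left (by positivity) ((pow_succ p k).symm.dvd.trans h'))
  · rintro ⟨y, rfl⟩
    have h0 : (p : ZMod (p ^ (k + 1))) ^ (k + 1) = 0 := by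
      exact_mod_cast ZMod.natCast_self (p ^ (k + 1))
    rw [← mul_assoc, Nat.succ_sub_one, ← pow_succ, h0, zero_mul]

theorem ZMod.natCast_prime_dvd_of_dvd_pow {p r : ℕ} (hp : p.Prime) (hr : r ≠ 0) {n : ℕ}
    {x : ZMod (p ^ r)} (h : (p : ZMod (p ^ r)) ∣ x ^ n) : (p : ZMod (p ^ r)) ∣ x := by
  have : NeZero (p ^ r) := ⟨pow_ne_zero r hp.ne_zero⟩
  have hdvd : p ∣ p ^ r := dvd_pow_self p hr
  have h' := map_dvd (ZMod.castHom hdvd (ZMod p)) h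
  rw [map_natCast, ZMod.natCast_self, zero_dvd_iff, ← ZMod.natCast_zmod_val x, map_pow,
    map_natCast, ← Nat.cast_pow, ZMod.natCast_eq_zero_iff] at h'
  rw [← ZMod.natCast_zmod_val x]
  exact Nat.cast_dvd_cast (hp.dvd_of_dvd_pow h')

open Matrix.SpecialLinearGroup in

/-- For an odd prime `p`, `r ≥ 2`, `u₀ = !![1, p^(r-1); 0, 1] ∈ SL₂(ℤ/p^r)` and `H` the
subgroup generated by `!![1,1;0,1]` and `-I₂`, one has `h·u₀·h⁻¹ ∈ H` iff the
`(2,1)`-entry of `h` is divisible by `p`. -/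
theorem conj_in_Gtilde_infty_iff (p r : ℕ) (hp : p.Prime) (hodd : Odd p) (hr : 2 ≤ r)
    (u₀ t w : Matrix.SpecialLinearGroup (Fin 2) (ZMod (p ^ r)))
    (hu₀ : u₀.val = !![1, (p : ZMod (p ^ r)) ^ (r - 1); 0, 1])
    (ht : t.val = !![1, 1; 0, 1]) (hw : w.val = !![-1, 0; 0, -1])
    (h : Matrix.SpecialLinearGroup (Fin 2) (ZMod (p ^ r))) :
    h * u₀ * h⁻¹ ∈ Subgroup.closure {t, w} ↔ (p : ZMod (p ^ r)) ∣ h.val 1 0 := by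
  have hr0 : r ≠ 0 := by omega
  have : NeZero (p ^ r) := ⟨pow_ne_zero r hp.ne_zero⟩
  have hconj := val_conj_of_val_eq_upper_unipotent hu₀ h
  constructor
  · intro hmem
    have h10 := val_one_zero_eq_zero_of_mem_closure (by simp [ht, hw]) hmem
    rw [hconj] at h10
    have hz : (p : ZMod (p ^ r)) ^ (r - 1) * h.val 1 0 ^ 2 = 0 := by simpa using h10
    exact ZMod.natCast_prime_dvd_of_dvd_pow hp hr0
      ((ZMod.natCast_pow_pred_mul_eq_zero_iff_dvd hp.ne_zero hr0 _).1 hz)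
  · intro hdvd
    have hz := fun y (hy : (p : ZMod (p ^ r)) ∣ y) ↦
      (ZMod.natCast_pow_pred_mul_eq_zero_iff_dvd hp.ne_zero hr0 y).2 hy
    have heq : h * u₀ * h⁻¹ =
        t ^ ((p : ZMod (p ^ r)) ^ (r - 1) * h.val 0 0 ^ 2).val := by
      apply Subtype.ext
      rw [hconj, val_pow_of_val_eq_upper_unipotent ht, ZMod.natCast_zmod_val,
        hz _ (hdvd.mul_left _), hz _ (dvd_pow hdvd two_ne_zero), sub_zero, neg_zero, add_zero]
    rw [heq]
    exact pow_mem (Subgroup.subset_closure (by simp)) _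
end

section
/- Let p be an odd prime and r ≥ 2 an integer. The conjugacy class of the matrix u₀ = [[1, p^{r−1}],[0,1]] in SL₂(ℤ/p^rℤ) has cardinality (p−1)(p+1)/2; equivalently, the centralizer of u₀ in SL₂(ℤ/p^rℤ) has order 2·p^{3r−2}. -/
/-- Reduction modulo `p` on `ZMod (p ^ r)`, for `r ≠ 0`. -/
def ZMod.reduceModPrime (p r : ℕ) (hr : r ≠ 0) : ZMod (p ^ r) →+* ZMod p :=
  ZMod.castHom (dvd_pow_self p hr) (ZMod p)

namespace ZMod

variable {p r : ℕ} (hr : r ≠ 0)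

theorem reduceModPrime_surjective : Function.Surjective (reduceModPrime p r hr) :=
  ZMod.castHom_surjective _

theorem prime_pow_mul_eq_zero_iff [Fact p.Prime] (x : ZMod (p ^ r)) :
    (p : ZMod (p ^ r)) ^ (r - 1) * x = 0 ↔ reduceModPrime p r hr x = 0 := by
  obtain ⟨n, rfl⟩ := ZMod.natCast_zmod_surjective x
  have hp : 0 < p := (Fact.out : p.Prime).pos
  rw [map_natCast, ← Nat.cast_pow, ← Nat.cast_mul, ZMod.natCast_eq_zero_iff,
    ZMod.natCast_eq_zero_iff]
  conv_lhs => lhs; rw [← Nat.sub_add_cancel (Nat.one_le_iff_ne_zero.mpr hr), pow_succ]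
  exact Nat.mul_dvd_mul_iff_left (pow_pos hp _)

theorem prime_pow_mul_eq_iff [Fact p.Prime] (x y : ZMod (p ^ r)) :
    (p : ZMod (p ^ r)) ^ (r - 1) * x = (p : ZMod (p ^ r)) ^ (r - 1) * y ↔
      reduceModPrime p r hr x = reduceModPrime p r hr y := by
  rw [← sub_eq_zero, ← mul_sub, prime_pow_mul_eq_zero_iff hr, map_sub, sub_eq_zero]

theorem isUnit_iff_reduceModPrime_ne_zero [Fact p.Prime] (x : ZMod (p ^ r)) :
    IsUnit x ↔ reduceModPrime p r hr x ≠ 0 := by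
  obtain ⟨n, rfl⟩ := ZMod.natCast_zmod_surjective x
  have hp : p.Prime := Fact.out
  rw [map_natCast, ZMod.isUnit_iff_coprime, Ne, ZMod.natCast_eq_zero_iff,
    Nat.coprime_pow_right_iff (Nat.pos_of_ne_zero hr), Nat.coprime_comm, hp.coprime_iff_not_dvd]

theorem card_reduceModPrime_fiber [Fact p.Prime] (y : ZMod p) :
    Nat.card {x // reduceModPrime p r hr x = y} = p ^ (r - 1) := by
  have hp : 0 < p := (Fact.out : p.Prime).pos
  obtain ⟨z, rfl⟩ := reduceModPrime_surjective hr y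
  let f := (reduceModPrime p r hr).toAddMonoidHom
  have e : {x // reduceModPrime p r hr x = reduceModPrime p r hr z} ≃ f.ker :=
    (Equiv.subRight z).subtypeEquiv fun x => by
      simp [f, AddMonoidHom.mem_ker, sub_eq_zero]
  rw [Nat.card_congr e]
  have h := f.ker.card_mul_index
  rw [AddSubgroup.index_ker, AddMonoidHom.range_eq_top.mpr (reduceModPrime_surjective hr),
    AddSubgroup.card_top, Nat.card_zmod, Nat.card_zmod] at h
  apply Nat.eq_of_mul_eq_mul_right hp
  rw [h, ← pow_succ, Nat.sub_add_cancel (Nat.one_le_iff_ne_zero.mpr hr)]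

end ZMod

/-- A function on a finite set whose fibres are the pairs `{v, -v}` is two-to-one. -/
theorem Finset.card_eq_two_mul_card_image_of_neg {V W : Type*} [DecidableEq V] [DecidableEq W]
    [Neg V] (s : Finset V) (f : V → W) (hs : ∀ v ∈ s, -v ∈ s) (hne : ∀ v ∈ s, v ≠ -v)
    (hf : ∀ v ∈ s, ∀ w ∈ s, f w = f v ↔ w = v ∨ w = -v) :
    s.card = 2 * (s.image f).card := by
  rw [Finset.card_eq_sum_card_image f s, Finset.sum_const_nat (m := 2), mul_comm]
  intro b hb
  obtain ⟨v, hv, rfl⟩ := Finset.mem_image.mp hb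
  have : {w ∈ s | f w = f v} = {v, -v} := by
    ext w
    simp only [Finset.mem_filter, Finset.mem_insert, Finset.mem_singleton]
    constructor
    · rintro ⟨hw, h⟩
      exact (hf v hv w hw).mp h
    · intro h
      have hw : w ∈ s := by
        rcases h with rfl | rfl
        · exact hv
        · exact hs v hv
      exact ⟨hw, (hf v hv w hw).mpr h⟩
  rw [this, Finset.card_pair (hne v hv)]

/-- Over a domain, the quadratic monomials determine a vector up to sign. -/
theorem quadratic_monomials_eq_iff {F : Type*} [CommRing F] [IsDomain F] (a c x y : F) :
    (a * c = x * y ∧ a ^ 2 = x ^ 2 ∧ c ^ 2 = y ^ 2) ↔ (a = x ∧ c = y) ∨ (a = -x ∧ c = -y) := by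
  constructor
  · rintro ⟨h, ha, hc⟩
    rcases sq_eq_sq_iff_eq_or_eq_neg.mp ha with rfl | rfl <;>
      rcases sq_eq_sq_iff_eq_or_eq_neg.mp hc with rfl | rfl
    · simp
    · by_cases h0 : a = 0
      · simp [h0]
      · left; exact ⟨rfl, mul_left_cancel₀ h0 h⟩
    · by_cases h0 : x = 0
      · simp [h0]
      · right
        exact ⟨rfl, mul_left_cancel₀ h0 (by linear_combination -h)⟩
    · simp
  · rintro (⟨rfl, rfl⟩ | ⟨rfl, rfl⟩) <;> simp

namespace Matrix.SpecialLinearGroup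

theorem exists_first_column {R : Type*} [CommRing R] {a c : R} (h : IsUnit a ∨ IsUnit c) :
    ∃ g : SpecialLinearGroup (Fin 2) R, g.val 0 0 = a ∧ g.val 1 0 = c := by
  rcases h with h | h <;> obtain ⟨u, rfl⟩ := h
  · exact ⟨⟨!![(u : R), 0; c, ((u⁻¹ : Rˣ) : R)], by simp [Matrix.det_fin_two]⟩, by simp, by simp⟩
  · exact ⟨⟨!![a, -((u⁻¹ : Rˣ) : R); (u : R), 0], by simp [Matrix.det_fin_two]⟩, by simp, by simp⟩

theorem coe_conj_transvection {R : Type*} [CommRing R] (t : R)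
    (u g : SpecialLinearGroup (Fin 2) R) (hu : u.val = !![1, t; 0, 1]) :
    (g * u * g⁻¹).val =
      !![1 - t * (g.val 0 0 * g.val 1 0), t * g.val 0 0 ^ 2;
        -(t * g.val 1 0 ^ 2), 1 + t * (g.val 0 0 * g.val 1 0)] := by
  have hd := g.det_coe
  rw [Matrix.det_fin_two] at hd
  change g.val * u.val * (g⁻¹).val = _
  have hinv : (g⁻¹).val = g.val.adjugate := SpecialLinearGroup.coe_inv g
  rw [hu, hinv, Matrix.adjugate_fin_two]
  ext i j
  fin_cases i <;> fin_cases j <;> simp [Matrix.mul_apply, Fin.sum_univ_two] <;>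
    first
    | linear_combination hd
    | ring

theorem mem_centralizer_transvection_iff {R : Type*} [CommRing R] (t : R)
    (u g : SpecialLinearGroup (Fin 2) R) (hu : u.val = !![1, t; 0, 1]) :
    g ∈ Subgroup.centralizer {u} ↔ t * g.val 1 0 = 0 ∧ t * g.val 0 0 = t * g.val 1 1 := by
  have : g ∈ Subgroup.centralizer {u} ↔ u.val * g.val = g.val * u.val := by
    rw [Subgroup.mem_centralizer_singleton_iff, eq_comm]
    exact Subtype.ext_iff
  rw [this, hu, ← Matrix.ext_iff]
  simp only [Fin.forall_fin_two, Matrix.mul_apply, Fin.sum_univ_two, Matrix.of_apply,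
    Matrix.cons_val', Matrix.cons_val_zero, Matrix.cons_val_one, Matrix.cons_val_fin_one]
  constructor
  · rintro ⟨⟨h1, h2⟩, -, -⟩
    exact ⟨by linear_combination h1, by linear_combination -h2⟩
  · rintro ⟨h1, h2⟩
    exact ⟨⟨by linear_combination h1, by linear_combination -h2⟩, by ring, by
      linear_combination -h1⟩

/-- Modulo `p`, an element centralizing `1 + p ^ (r - 1) E₁₂` is upper triangular with both
diagonal entries `1` or both `-1`. -/
theorem mem_centralizer_iff_reduceModPrime {p r : ℕ} [Fact p.Prime] (hr : r ≠ 0)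
    (u g : SpecialLinearGroup (Fin 2) (ZMod (p ^ r)))
    (hu : u.val = !![1, (p : ZMod (p ^ r)) ^ (r - 1); 0, 1]) :
    g ∈ Subgroup.centralizer {u} ↔
      (ZMod.reduceModPrime p r hr (g.val 0 0) = 1 ∨ ZMod.reduceModPrime p r hr (g.val 0 0) = -1) ∧
        ZMod.reduceModPrime p r hr (g.val 1 0) = 0 := by
  rw [mem_centralizer_transvection_iff _ u g hu, ZMod.prime_pow_mul_eq_zero_iff hr,
    ZMod.prime_pow_mul_eq_iff hr]
  have hd := congrArg (ZMod.reduceModPrime p r hr) g.det_coe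
  rw [Matrix.det_fin_two, map_sub, map_mul, map_mul, map_one] at hd
  constructor
  · rintro ⟨hc, had⟩
    rw [hc, ← had, mul_zero, sub_zero] at hd
    exact ⟨mul_self_eq_one_iff.mp hd, hc⟩
  · rintro ⟨ha, hc⟩
    rw [hc, mul_zero, sub_zero] at hd
    refine ⟨hc, ?_⟩
    have ha := mul_self_eq_one_iff.mpr ha
    linear_combination ZMod.reduceModPrime p r hr (g.val 1 1) * ha -
      ZMod.reduceModPrime p r hr (g.val 0 0) * hd

/-- An element of the centralizer of `1 + p ^ (r - 1) E₁₂` is determined by its entries other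
than the lower right one. -/
def centralizerEquiv {p r : ℕ} [Fact p.Prime] (hr : r ≠ 0)
    (u : SpecialLinearGroup (Fin 2) (ZMod (p ^ r)))
    (hu : u.val = !![1, (p : ZMod (p ^ r)) ^ (r - 1); 0, 1]) :
    (Subgroup.centralizer {u} : Subgroup (SpecialLinearGroup (Fin 2) (ZMod (p ^ r)))) ≃
      {a // ZMod.reduceModPrime p r hr a = 1 ∨ ZMod.reduceModPrime p r hr a = -1} ×
        ZMod (p ^ r) × {c // ZMod.reduceModPrime p r hr c = 0} where
  toFun g :=
    have h := (mem_centralizer_iff_reduceModPrime hr u g.1 hu).mp g.2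
    (⟨g.1.val 0 0, h.1⟩, g.1.val 0 1, ⟨g.1.val 1 0, h.2⟩)
  invFun x :=
    ⟨⟨!![x.1.1, x.2.1; x.2.2.1, x.1.1⁻¹ * (1 + x.2.1 * x.2.2.1)], by
      have ha : IsUnit x.1.1 := (ZMod.isUnit_iff_reduceModPrime_ne_zero hr _).mpr (by
        rcases x.1.2 with h | h <;> simp [h])
      rw [Matrix.det_fin_two_of, ← mul_assoc, ZMod.mul_inv_of_unit _ ha]
      ring⟩,
      (mem_centralizer_iff_reduceModPrime hr u _ hu).mpr (by
        simpa using ⟨x.1.2, x.2.2.2⟩)⟩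
  left_inv g := by
    have h := (mem_centralizer_iff_reduceModPrime hr u g.1 hu).mp g.2
    have ha : IsUnit (g.1.val 0 0) := (ZMod.isUnit_iff_reduceModPrime_ne_zero hr _).mpr (by
        rcases h.1 with h | h <;> simp [h])
    have hd := g.1.det_coe
    rw [Matrix.det_fin_two] at hd
    have h11 : (g.1.val 0 0)⁻¹ * (1 + g.1.val 0 1 * g.1.val 1 0) = g.1.val 1 1 := by
      have hi := ZMod.mul_inv_of_unit _ ha
      linear_combination g.1.val 1 1 * hi - (g.1.val 0 0)⁻¹ * hd
    apply Subtype.ext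
    apply Subtype.ext
    ext i j
    fin_cases i <;> fin_cases j
    · rfl
    · rfl
    · rfl
    · exact h11
  right_inv x := rfl

theorem card_centralizer {p r : ℕ} [Fact p.Prime] (hp : p ≠ 2) (hr : r ≠ 0)
    (u : SpecialLinearGroup (Fin 2) (ZMod (p ^ r)))
    (hu : u.val = !![1, (p : ZMod (p ^ r)) ^ (r - 1); 0, 1]) :
    Nat.card (Subgroup.centralizer {u} :
      Subgroup (SpecialLinearGroup (Fin 2) (ZMod (p ^ r)))) = 2 * p ^ (3 * r - 2) := by
  have : Fact (2 < p) := ⟨(Fact.out : p.Prime).two_le.lt_of_ne' hp⟩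
  have : NeZero (p ^ r) := ⟨pow_ne_zero _ (Fact.out : p.Prime).ne_zero⟩
  have hdisj : Disjoint (fun a => ZMod.reduceModPrime p r hr a = 1)
      (fun a => ZMod.reduceModPrime p r hr a = -1) := by
    rw [Pi.disjoint_iff]
    intro a
    rw [Prop.disjoint_iff]
    rintro ⟨h, h'⟩
    exact ZMod.neg_one_ne_one (h'.symm.trans h)
  classical
  rw [Nat.card_congr (centralizerEquiv hr u hu), Nat.card_prod, Nat.card_prod, Nat.card_zmod,
    ZMod.card_reduceModPrime_fiber, Nat.card_congr (subtypeOrEquiv _ _ hdisj), Nat.card_sum,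
    ZMod.card_reduceModPrime_fiber, ZMod.card_reduceModPrime_fiber, ← two_mul, mul_assoc,
    ← pow_add, ← pow_add]
  congr 2
  omega

theorem ncard_conjClass {p r : ℕ} [Fact p.Prime] (hp : p ≠ 2) (hr : r ≠ 0)
    (u : SpecialLinearGroup (Fin 2) (ZMod (p ^ r)))
    (hu : u.val = !![1, (p : ZMod (p ^ r)) ^ (r - 1); 0, 1]) :
    2 * Set.ncard {x | ∃ g, g * u * g⁻¹ = x} = p ^ 2 - 1 := by
  classical
  have : Fact (2 < p) := ⟨(Fact.out : p.Prime).two_le.lt_of_ne' hp⟩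
  let π := ZMod.reduceModPrime p r hr
  let P : ZMod (p ^ r) := (p : ZMod (p ^ r)) ^ (r - 1)
  let M (a c : ZMod (p ^ r)) : Matrix (Fin 2) (Fin 2) (ZMod (p ^ r)) :=
    !![1 - P * (a * c), P * a ^ 2; -(P * c ^ 2), 1 + P * (a * c)]
  have hM (a c x y : ZMod (p ^ r)) :
      M a c = M x y ↔ (π a = π x ∧ π c = π y) ∨ (π a = -π x ∧ π c = -π y) := by
    rw [← quadratic_monomials_eq_iff, ← map_mul, ← map_mul, ← map_pow, ← map_pow, ← map_pow,
      ← map_pow, ← ZMod.prime_pow_mul_eq_iff hr, ← ZMod.prime_pow_mul_eq_iff hr,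
      ← ZMod.prime_pow_mul_eq_iff hr, ← Matrix.ext_iff]
    simp only [M, P, Fin.forall_fin_two, Matrix.of_apply, Matrix.cons_val', Matrix.cons_val_zero,
      Matrix.cons_val_one, Matrix.cons_val_fin_one, sub_right_inj, neg_inj, add_right_inj]
    tauto
  choose s hs using ZMod.reduceModPrime_surjective (p := p) hr
  let f (v : ZMod p × ZMod p) := M (s v.1) (s v.2)
  let S : Finset (ZMod p × ZMod p) := Finset.univ.erase 0
  have hcard : S.card = 2 * (S.image f).card := by
    apply Finset.card_eq_two_mul_card_image_of_neg
    · simp [S]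
    · rintro ⟨a, c⟩ hv h
      rw [Prod.neg_mk, Prod.mk.injEq] at h
      have hodd : Odd p := (Fact.out : p.Prime).odd_of_ne_two hp
      have ha : a = 0 := by_contra fun ha => ZMod.ne_neg_self hodd ha h.1
      have hc : c = 0 := by_contra fun hc => ZMod.ne_neg_self hodd hc h.2
      simp [S, ha, hc] at hv
    · intro v _ w _
      simp only [f, hM, π, hs, Prod.ext_iff, Prod.fst_neg, Prod.snd_neg]
  have himage : Subtype.val '' {x | ∃ g, g * u * g⁻¹ = x} = (S.image f : Set _) := by
    ext m
    simp only [Set.mem_image, Set.mem_ofPred_eq, Finset.coe_image, Finset.mem_coe]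
    constructor
    · rintro ⟨_, ⟨g, rfl⟩, rfl⟩
      refine ⟨(π (g.val 0 0), π (g.val 1 0)), ?_, ?_⟩
      · have hd := congrArg π g.det_coe
        rw [Matrix.det_fin_two, map_sub, map_mul, map_mul, map_one] at hd
        simp only [S, Finset.mem_erase, Finset.mem_univ, and_true, ne_eq, Prod.mk_eq_zero]
        rintro ⟨h0, h1⟩
        simp [h0, h1] at hd
      · exact ((hM _ _ _ _).mpr (Or.inl ⟨hs _, hs _⟩)).trans
          (coe_conj_transvection _ u g hu).symm
    · rintro ⟨⟨a, c⟩, hv, rfl⟩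
      have hunit : IsUnit (s a) ∨ IsUnit (s c) := by
        rw [ZMod.isUnit_iff_reduceModPrime_ne_zero hr, ZMod.isUnit_iff_reduceModPrime_ne_zero hr,
          hs, hs, ← not_and_or]
        simpa [S] using hv
      obtain ⟨g, ha, hc⟩ := exists_first_column hunit
      exact ⟨_, ⟨g, rfl⟩,
        (coe_conj_transvection _ u g hu).trans (by rw [ha, hc])⟩
  have hncard : Set.ncard {x | ∃ g, g * u * g⁻¹ = x} = (S.image f).card := by
    rw [← Set.ncard_coe_finset, ← himage]
    exact (Set.ncard_image_of_injective _ Subtype.val_injective).symm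
  rw [hncard, ← hcard]
  simp [S, Finset.card_erase_of_mem, ZMod.card, sq]

end Matrix.SpecialLinearGroup


/-- For an odd prime `p` and `r ≥ 2`, the conjugacy class of
`u₀ = !![1, p^(r-1); 0, 1]` in `SL₂(ℤ/p^r)` has cardinality `(p-1)(p+1)/2`;
equivalently, the centralizer of `u₀` has order `2·p^(3r-2)`. -/
theorem conj_class_card_u₀ (p r : ℕ) (hp : p.Prime) (hodd : Odd p) (hr : 2 ≤ r)
    (u₀ : Matrix.SpecialLinearGroup (Fin 2) (ZMod (p ^ r)))
    (hu₀ : u₀.val = !![1, (p : ZMod (p ^ r)) ^ (r - 1); 0, 1]) :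
    Set.ncard {x : Matrix.SpecialLinearGroup (Fin 2) (ZMod (p ^ r)) |
        ∃ g, g * u₀ * g⁻¹ = x} = (p - 1) * (p + 1) / 2 ∧
    Nat.card (Subgroup.centralizer {u₀} :
        Subgroup (Matrix.SpecialLinearGroup (Fin 2) (ZMod (p ^ r)))) =
      2 * p ^ (3 * r - 2) := by
  have : Fact p.Prime := ⟨hp⟩
  have hp2 : p ≠ 2 := by
    rintro rfl
    exact absurd hodd (by decide)
  have hr0 : r ≠ 0 := by omega
  refine ⟨?_, Matrix.SpecialLinearGroup.card_centralizer hp2 hr0 u₀ hu₀⟩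
  have h := Matrix.SpecialLinearGroup.ncard_conjClass hp2 hr0 u₀ hu₀
  rw [mul_comm (p - 1), ← Nat.sq_sub_sq p 1, one_pow, ← h, Nat.mul_div_cancel_left _ two_pos]
end

section
/- Let p be an odd prime and r ≥ 2 an integer, and set N = p^{2(r−2)}·(p−1)·(p^r + p^{r−1} − 6). Then 12 divides N, and the integer N/12 is odd if and only if p ≡ 3 (mod 4). -/
/-- For an odd prime `p` and `r ≥ 2`, with `N = p^(2(r-2))·(p-1)·(p^r + p^(r-1) - 6)`,
`12` divides `N`, and `N/12` is odd if and only if `p ≡ 3 (mod 4)`. -/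
theorem multiplicity_sum_parity (p r : ℕ) (hp : p.Prime) (hodd : Odd p) (hr : 2 ≤ r) :
    12 ∣ p ^ (2 * (r - 2)) * (p - 1) * (p ^ r + p ^ (r - 1) - 6) ∧
    (Odd (p ^ (2 * (r - 2)) * (p - 1) * (p ^ r + p ^ (r - 1) - 6) / 12) ↔ p % 4 = 3) := by
  obtain ⟨k, rfl⟩ := Nat.exists_eq_add_of_le' hr
  have hp3 : 3 ≤ p := by
    have := hp.two_le
    obtain ⟨a, rfl⟩ := hodd
    omega
  have hpq : p ∣ p ^ (k + 1) := dvd_pow_self p k.succ_ne_zero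
  have hle : p ≤ p ^ (k + 1) := Nat.le_of_dvd (pow_pos hp.pos _) hpq
  have hA : Odd (p ^ (2 * k)) := hodd.pow
  have hq : Odd (p ^ (k + 1)) := hodd.pow
  have hsum : p ^ (k + 2) + p ^ (k + 1) = p ^ (k + 1) * (p + 1) := by ring
  rw [show k + 2 - 2 = k by omega, show k + 2 - 1 = k + 1 by omega, hsum]
  generalize p ^ (2 * k) = A at *
  generalize p ^ (k + 1) = q at *
  obtain ⟨M, hM⟩ : ∃ M, q * (p + 1) = M + 6 :=
    Nat.exists_eq_add_of_le' (by nlinarith)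
  rw [hM, Nat.add_sub_cancel]
  have h3 : 3 ∣ A * (p - 1) * M := by
    by_cases h1 : p % 3 = 1
    · exact ((show 3 ∣ p - 1 by omega).mul_left A).mul_right M
    · have : 3 ∣ q * (p + 1) := by
        by_cases h0 : 3 ∣ p
        · exact (h0.trans hpq).mul_right _
        · exact (show 3 ∣ p + 1 by omega).mul_left q
      exact (show 3 ∣ M by omega).mul_left _
  obtain ⟨b, rfl⟩ := hq
  obtain h4 | h4 : p % 4 = 1 ∨ p % 4 = 3 := by
    obtain ⟨a, rfl⟩ := hodd
    omega
  · obtain ⟨a, rfl⟩ : ∃ a, p = 4 * a + 1 := ⟨p / 4, by omega⟩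
    have hM4 : 4 ∣ M := by
      have : M + 6 = 4 * (2 * (a * b) + b + a) + 2 := by rw [← hM]; ring
      omega
    have h16 : 16 ∣ A * (4 * a + 1 - 1) * M :=
      mul_dvd_mul (a := 4) (c := 4) ((show 4 ∣ 4 * a + 1 - 1 by simp).mul_left A) hM4
    rw [Nat.odd_iff]
    omega
  · obtain ⟨a, rfl⟩ : ∃ a, p = 4 * a + 3 := ⟨p / 4, by omega⟩
    obtain ⟨c, rfl⟩ : ∃ c, M = 2 * (2 * c + 1) := by
      have : M + 6 = 4 * ((a + 1) * (2 * b + 1)) := by rw [← hM]; ring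
      exact ⟨M / 4, by omega⟩
    obtain ⟨d, hd⟩ : Odd (A * (2 * a + 1) * (2 * c + 1)) :=
      (hA.mul (odd_two_mul_add_one a)).mul (odd_two_mul_add_one c)
    have hN : A * (4 * a + 3 - 1) * (2 * (2 * c + 1)) = 4 * (2 * d + 1) := by
      rw [← hd, show 4 * a + 3 - 1 = 2 * (2 * a + 1) by omega]
      ring
    rw [Nat.odd_iff]
    omega
end
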